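/- Let K, N be positive integers, R̂ ∈ ℝ^{KN×KN} a symmetric matrix, α > 0, and W = (W^{[k]})_{1≤k≤K} a collection of N×N real matrices. Define h(W,C) = (1/2)·Σ_{n=1}^N [tr(C_n W_n R̂ W_nᵀ) + α·‖diag(C_n) − 1_K‖²] for N-tuples C of K×K real matrices. Then C ↦ h(W,C) is differentiable with gradient given blockwise by ∇_{C_n} h(W,C) = (1/2)·W_n R̂ W_nᵀ + α·(Diag(C_n) − I_K) for every n, and the gradient map C ↦ ∇_C h(W,C) is Lipschitz continuous with constant α with respect to the Frobenius norm on ℝ^{K×K×N}. -/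

import Mathlib

open Matrix

/-- `blockRow W n` is the K×(K·N) block matrix `W_n` whose k-th row carries the n-th row
of `W^{[k]}` in the k-th block of columns (columns are indexed by `Fin K × Fin N`). -/
def blockRow {K N : ℕ} (W : Fin K → Matrix (Fin N) (Fin N) ℝ) (n : Fin N) :
    Matrix (Fin K) (Fin K × Fin N) ℝ :=
  Matrix.of fun k p => if p.1 = k then W k n p.2 else 0

/-- Frobenius norm of an N-tuple of K×K matrices (a third-order tensor). -/
noncomputable def frobT {N K₁ K₂ : ℕ} (T : Fin N → Matrix (Fin K₁) (Fin K₂) ℝ) : ℝ :=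
  Real.sqrt (∑ n, ∑ i, ∑ j, (T n i j) ^ 2)

/-- The smooth term `h(W,C) = (1/2)·Σₙ [tr(Cₙ Wₙ R̂ Wₙᵀ) + α·‖diag(Cₙ) − 1_K‖²]`,
with `C` represented as an element of `ℝ^{K×K×N}`. -/
noncomputable def hFun {K N : ℕ} (R : Matrix (Fin K × Fin N) (Fin K × Fin N) ℝ) (α : ℝ)
    (W : Fin K → Matrix (Fin N) (Fin N) ℝ) (C : Fin N → Fin K → Fin K → ℝ) : ℝ :=
  (1/2) * ∑ n, ((Matrix.of (C n) * blockRow W n * R * (blockRow W n)ᵀ).trace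
      + α * ∑ k, (C n k k - 1) ^ 2)

/-- The blockwise gradient `∇_{Cₙ} h(W,C) = (1/2)·Wₙ R̂ Wₙᵀ + α·(Diag(Cₙ) − I_K)`. -/
noncomputable def gradCh {K N : ℕ} (R : Matrix (Fin K × Fin N) (Fin K × Fin N) ℝ) (α : ℝ)
    (W : Fin K → Matrix (Fin N) (Fin N) ℝ) (C : Fin N → Fin K → Fin K → ℝ) :
    Fin N → Matrix (Fin K) (Fin K) ℝ :=
  fun n => (1/2 : ℝ) • (blockRow W n * R * (blockRow W n)ᵀ)
    + α • (Matrix.diagonal (fun k => C n k k) - 1)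

/-- The `(n, i, j)` coordinate functional on `ℝ^{K×K×N}`. -/
def coordCLM {K N : ℕ} (n : Fin N) (i j : Fin K) : (Fin N → Fin K → Fin K → ℝ) →L[ℝ] ℝ :=
  (ContinuousLinearMap.proj (R := ℝ) (φ := fun _ : Fin K => ℝ) j).comp
    ((ContinuousLinearMap.proj (R := ℝ) (φ := fun _ : Fin K => Fin K → ℝ) i).comp
      (ContinuousLinearMap.proj (R := ℝ) (φ := fun _ : Fin N => Fin K → Fin K → ℝ) n))

lemma hasFDerivAt_coord {K N : ℕ} (n : Fin N) (i j : Fin K) (C : Fin N → Fin K → Fin K → ℝ) :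
    HasFDerivAt (fun C : Fin N → Fin K → Fin K → ℝ => C n i j) (coordCLM n i j) C :=
  (coordCLM n i j).hasFDerivAt

lemma blockRow_gram_symm {K N : ℕ} {R : Matrix (Fin K × Fin N) (Fin K × Fin N) ℝ} (hR : Rᵀ = R)
    (W : Fin K → Matrix (Fin N) (Fin N) ℝ) (n : Fin N) :
    (blockRow W n * R * (blockRow W n)ᵀ)ᵀ = blockRow W n * R * (blockRow W n)ᵀ := by
  rw [transpose_mul, transpose_mul, transpose_transpose, hR, Matrix.mul_assoc]

lemma hFun_eq_sum {K N : ℕ} (R : Matrix (Fin K × Fin N) (Fin K × Fin N) ℝ) (α : ℝ)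
    (W : Fin K → Matrix (Fin N) (Fin N) ℝ) :
    hFun R α W = fun C => (1/2) * ∑ n,
      ((∑ i, ∑ j, C n i j * (blockRow W n * R * (blockRow W n)ᵀ) j i)
        + α * ∑ k, (C n k k - 1) ^ 2) := by
  funext C
  unfold hFun
  congr 1
  refine Finset.sum_congr rfl fun n _ => ?_
  rw [Matrix.mul_assoc, Matrix.mul_assoc, ← Matrix.mul_assoc (blockRow W n)]
  simp only [Matrix.trace, Matrix.diag_apply, Matrix.mul_apply (M := Matrix.of (C n)),
    Matrix.of_apply]

lemma hasFDerivAt_hFun {K N : ℕ} (R : Matrix (Fin K × Fin N) (Fin K × Fin N) ℝ) (α : ℝ)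
    (W : Fin K → Matrix (Fin N) (Fin N) ℝ) (C : Fin N → Fin K → Fin K → ℝ) :
    HasFDerivAt (hFun R α W) ((1/2 : ℝ) • ∑ n,
      ((∑ i, ∑ j, (blockRow W n * R * (blockRow W n)ᵀ) j i • coordCLM n i j)
        + α • ∑ k, (2 * (C n k k - 1)) • coordCLM n k k)) C := by
  rw [hFun_eq_sum]
  refine (HasFDerivAt.fun_sum fun n _ => HasFDerivAt.add
    (HasFDerivAt.fun_sum fun i _ => HasFDerivAt.fun_sum fun j _ =>
      (hasFDerivAt_coord n i j C).mul_const _)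
    ((HasFDerivAt.fun_sum fun k _ => ?_).const_mul α)).const_mul (1/2)
  simpa using ((hasFDerivAt_coord n k k C).sub_const 1).pow 2

lemma trace_gradCh_mul {K N : ℕ} {R : Matrix (Fin K × Fin N) (Fin K × Fin N) ℝ} (hR : Rᵀ = R)
    (α : ℝ) (W : Fin K → Matrix (Fin N) (Fin N) ℝ) (C H : Fin N → Fin K → Fin K → ℝ)
    (n : Fin N) :
    ((gradCh R α W C n)ᵀ * Matrix.of (H n)).trace =
      (1/2) * ((∑ i, ∑ j, (blockRow W n * R * (blockRow W n)ᵀ) j i * H n i j)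
        + α * ∑ k, 2 * (C n k k - 1) * H n k k) := by
  have hdiag : diagonal (fun k => C n k k) - 1 = diagonal (fun k => C n k k - 1) := by
    rw [← diagonal_one, diagonal_sub]
  rw [gradCh, hdiag, transpose_add, transpose_smul, transpose_smul, blockRow_gram_symm hR,
    diagonal_transpose, Matrix.add_mul, trace_add, Matrix.smul_mul, Matrix.smul_mul, trace_smul,
    trace_smul, Matrix.trace_mul_comm (blockRow W n * R * (blockRow W n)ᵀ)]
  simp only [Matrix.trace, Matrix.diag_apply, Matrix.mul_apply (M := Matrix.of (H n)),
    Matrix.of_apply, Matrix.diagonal_mul, smul_eq_mul, mul_assoc, ← Finset.mul_sum,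
    mul_comm (H n _ _)]
  ring

lemma gradCh_sub_apply {K N : ℕ} (R : Matrix (Fin K × Fin N) (Fin K × Fin N) ℝ) (α : ℝ)
    (W : Fin K → Matrix (Fin N) (Fin N) ℝ) (C C' : Fin N → Fin K → Fin K → ℝ) (n : Fin N)
    (i j : Fin K) :
    (gradCh R α W C n - gradCh R α W C' n) i j =
      α * if i = j then C n i j - C' n i j else 0 := by
  rcases eq_or_ne i j with rfl | h
  · simp [gradCh]
    ring
  · simp [gradCh, h]

lemma frobT_le_mul_frobT {N K₁ K₂ : ℕ} {S T : Fin N → Matrix (Fin K₁) (Fin K₂) ℝ} {c : ℝ}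
    (hc : 0 ≤ c) (h : ∀ n i j, (S n i j) ^ 2 ≤ c ^ 2 * (T n i j) ^ 2) :
    frobT S ≤ c * frobT T := by
  unfold frobT
  rw [← Real.sqrt_sq hc, ← Real.sqrt_mul (sq_nonneg c)]
  simp only [Finset.mul_sum]
  gcongr
  exact h _ _ _

/-- `C ↦ h(W,C)` is differentiable with blockwise gradient
`∇_{Cₙ} h(W,C) = (1/2)·Wₙ R̂ Wₙᵀ + α·(Diag(Cₙ) − I_K)` (i.e. its Fréchet derivative is
`H ↦ Σₙ tr((∇_{Cₙ}h)ᵀ Hₙ)`), and the gradient map is Lipschitz continuous with constant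
`α` for the Frobenius norm on `ℝ^{K×K×N}`. -/
theorem stmt7 (K N : ℕ) (hK : 0 < K) (hN : 0 < N)
    (R : Matrix (Fin K × Fin N) (Fin K × Fin N) ℝ) (hR : Rᵀ = R)
    (α : ℝ) (hα : 0 < α)
    (W : Fin K → Matrix (Fin N) (Fin N) ℝ) :
    Differentiable ℝ (hFun R α W) ∧
    (∀ (C H : Fin N → Fin K → Fin K → ℝ),
      fderiv ℝ (hFun R α W) C H = ∑ n, ((gradCh R α W C n)ᵀ * Matrix.of (H n)).trace) ∧
    (∀ C C' : Fin N → Fin K → Fin K → ℝ,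
      frobT (fun n => gradCh R α W C n - gradCh R α W C' n) ≤
        α * frobT (fun n => Matrix.of (C n) - Matrix.of (C' n))) := by
  refine ⟨fun C => (hasFDerivAt_hFun R α W C).differentiableAt, fun C H => ?_, fun C C' => ?_⟩
  · rw [(hasFDerivAt_hFun R α W C).fderiv]
    simp only [trace_gradCh_mul hR, ← Finset.mul_sum]
    simp [coordCLM]
  · refine frobT_le_mul_frobT hα.le fun n i j => ?_
    rw [gradCh_sub_apply, mul_pow]
    refine mul_le_mul_of_nonneg_left ?_ (sq_nonneg α)
    split_ifs
    · simp
    · simp [sq_nonneg]
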